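/- arXiv:2003.00614 — 3 statements merged into one kernel-verified Lean document; each statement's English description precedes it below -/
import Mathlib

section
/- Let G be a connected simple graph on a finite vertex type V, let u be a vertex, let b ≥ 1 and r ≥ 1 be natural numbers. If |B(u,r)| > b² and |B(u,r-1)| ≤ b, then there exists a vertex w with dist(u,w) = r-1 and |B(w,1)| > b. -/
/-- In a connected graph, every vertex at positive distance from `u` is adjacent to a vertex
that is one step closer to `u`. -/
theorem SimpleGraph.Connected.exists_adj_dist_eq {V : Type*} {G : SimpleGraph V}
    (hG : G.Connected) {u v : V} {n : ℕ} (h : G.dist u v = n + 1) :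
    ∃ w : V, G.Adj w v ∧ G.dist u w = n := by
  obtain ⟨p, hp⟩ := hG.exists_walk_length_eq_dist v u
  rw [SimpleGraph.dist_comm, h] at hp
  cases p with
  | nil => simp at hp
  | @cons _ w _ hadj q =>
    refine ⟨w, hadj.symm, ?_⟩
    have hq : G.dist w u ≤ q.length := SimpleGraph.dist_le q
    have htri : G.dist u v ≤ G.dist u w + G.dist w v := hG.dist_triangle
    have hone : G.dist w v = 1 := SimpleGraph.dist_eq_one_iff_adj.2 hadj.symm
    rw [SimpleGraph.dist_comm] at hq
    rw [SimpleGraph.Walk.length_cons] at hp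
    lia


/-- Pigeonhole step of the hash-table size lower bound: if the ball of radius `r` around `u`
has more than `b²` vertices while the ball of radius `r - 1` has at most `b` vertices, then
some vertex `w` at distance exactly `r - 1` from `u` has more than `b` vertices within
distance `1`. -/
theorem exists_big_unit_ball {V : Type*} [Fintype V] (G : SimpleGraph V)
    (hG : G.Connected) (u : V) (b r : ℕ) (hb : 1 ≤ b) (hr : 1 ≤ r)
    (hbig : b ^ 2 < {v | G.dist u v ≤ r}.ncard)
    (hsmall : {v | G.dist u v ≤ r - 1}.ncard ≤ b) :
    ∃ w : V, G.dist u w = r - 1 ∧ b < {v | G.dist w v ≤ 1}.ncard := by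
  classical
  by_contra! hcon
  obtain ⟨n, rfl⟩ : ∃ n, r = n + 1 := ⟨r - 1, by lia⟩
  simp only [Nat.add_sub_cancel, Set.ncard_eq_toFinset_card'] at hsmall hbig hcon
  let star : V → Finset V := fun w ↦
    if G.dist u w = n then {v | G.dist w v ≤ 1}.toFinset else {w}
  have hstar (w : V) : (star w).card ≤ b := by
    by_cases hw : G.dist u w = n
    · simpa [star, hw] using hcon w hw
    · simpa [star, hw] using hb
  have hcover : {v | G.dist u v ≤ n + 1}.toFinset ⊆
      {v | G.dist u v ≤ n}.toFinset.biUnion star := by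
    intro v hv
    rw [Set.mem_toFinset, Set.mem_ofPred_eq] at hv
    simp only [Finset.mem_biUnion, Set.mem_toFinset, Set.mem_ofPred_eq]
    rcases hv.lt_or_eq with hlt | heq
    · refine ⟨v, by lia, ?_⟩
      by_cases hv' : G.dist u v = n <;> simp [star, hv']
    · obtain ⟨w, hadj, hw⟩ := hG.exists_adj_dist_eq heq
      exact ⟨w, hw.le, by simp [star, hw, SimpleGraph.dist_eq_one_iff_adj.2 hadj]⟩
  have hle := (Finset.card_le_card hcover).trans
    (Finset.card_biUnion_le_card_mul _ star b fun w _ ↦ hstar w)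
  nlinarith [Nat.mul_le_mul_right b hsmall]
end

section
/- Let m be a real number and let n : ℕ → ℝ be a sequence of positive reals with m ≥ n(1) and m/n(1) > 1, such that for all i ≥ 1, n(i+1) ≤ n(i) / (m/n(i))^{1/72}. Then for every natural number t ≥ 0, m/n(t+1) ≥ (m/n(1))^{(73/72)^t}. In particular, if t is a natural number with (73/72)^t ≥ log_{m/n(1)} m, then n(t+1) ≤ 1. -/
/-- Double-exponential progress: if `n (i+1) ≤ n i / (m / n i)^{1/72}` for all `i ≥ 1`,
with `m ≥ n 1 > 0` and `m / n 1 > 1`, then `m / n (t+1) ≥ (m / n 1)^{(73/72)^t}` for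
every `t`; in particular, once `(73/72)^t ≥ log_{m / n 1} m`, we have `n (t+1) ≤ 1`. -/
theorem double_exponential_progress (m : ℝ) (n : ℕ → ℝ)
    (hpos : ∀ i, 0 < n i) (hm : n 1 ≤ m) (hratio : 1 < m / n 1)
    (hrec : ∀ i, 1 ≤ i → n (i + 1) ≤ n i / (m / n i) ^ ((1 : ℝ) / 72)) :
    (∀ t : ℕ, (m / n 1) ^ (((73 / 72 : ℝ)) ^ t) ≤ m / n (t + 1)) ∧
      (∀ t : ℕ, Real.logb (m / n 1) m ≤ ((73 / 72 : ℝ)) ^ t → n (t + 1) ≤ 1) := by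
  have hm0 : 0 < m := (hpos 1).trans_le hm
  have hbase : 0 < m / n 1 := one_pos.trans hratio
  have hgrowth : ∀ t : ℕ, (m / n 1) ^ (((73 / 72 : ℝ)) ^ t) ≤ m / n (t + 1) := by
    intro t
    induction t with
    | zero => simp
    | succ t ih =>
      have hr : 0 < m / n (t + 1) := div_pos hm0 (hpos _)
      calc (m / n 1) ^ ((73 / 72 : ℝ) ^ (t + 1))
          = ((m / n 1) ^ ((73 / 72 : ℝ) ^ t)) ^ (73 / 72 : ℝ) := by
            rw [← Real.rpow_mul hbase.le, pow_succ]
        _ ≤ (m / n (t + 1)) ^ (73 / 72 : ℝ) :=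
            Real.rpow_le_rpow (Real.rpow_nonneg hbase.le _) ih (by norm_num)
        _ = (m / n (t + 1)) * (m / n (t + 1)) ^ ((1 : ℝ) / 72) := by
            rw [← Real.rpow_one_add' hr.le (by norm_num)]
            norm_num
        _ = m / (n (t + 1) / (m / n (t + 1)) ^ ((1 : ℝ) / 72)) := by
            rw [div_div_eq_mul_div, div_mul_eq_mul_div]
        _ ≤ m / n (t + 1 + 1) :=
            div_le_div_of_nonneg_left hm0.le (hpos _) (hrec (t + 1) (by omega))
  refine ⟨hgrowth, fun t ht => ?_⟩
  have hle : m ≤ m / n (t + 1) :=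
    ((Real.logb_le_iff_le_rpow hratio hm0).1 ht).trans (hgrowth t)
  rw [le_div_iff₀ (hpos _)] at hle
  exact le_of_mul_le_mul_left (hle.trans_eq (mul_one m).symm) hm0
end

section
/- Let a : ℕ → ℕ be a sequence of natural numbers such that a(t+1) ≤ ⌈a(t)/2⌉ + 1 for every t. Then for every natural number t, (a(t) : ℝ) ≤ max 3 ((4/5)^t · a(0)). In particular, if (4/5)^t · a(0) < 4 then a(t) ≤ 3. -/
/-- Tree-height recurrence: if `a (t+1) ≤ ⌈a t / 2⌉ + 1` for every `t`, then
`a t ≤ max 3 ((4/5)^t · a 0)`; in particular once `(4/5)^t · a 0 < 4` we get `a t ≤ 3`.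
(For a natural number `k`, `⌈k / 2⌉ = (k + 1) / 2` with natural division.) -/
theorem tree_height_recurrence (a : ℕ → ℕ)
    (hrec : ∀ t, a (t + 1) ≤ (a t + 1) / 2 + 1) :
    (∀ t, (a t : ℝ) ≤ max 3 ((4 / 5 : ℝ) ^ t * a 0)) ∧
      (∀ t, (4 / 5 : ℝ) ^ t * a 0 < 4 → a t ≤ 3) := by
  have bound : ∀ t, (a t : ℝ) ≤ max 3 ((4 / 5 : ℝ) ^ t * a 0) := by
    intro t
    induction t with
    | zero => simp
    | succ t ih =>
      have h := hrec t
      by_cases h3 : a (t + 1) ≤ 3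
      · exact le_max_of_le_left (by exact_mod_cast h3)
      · have step : (5 : ℝ) * a (t + 1) ≤ 4 * a t := by
          exact_mod_cast (by omega : 5 * a (t + 1) ≤ 4 * a t)
        have h4 : (4 : ℝ) ≤ a t := by exact_mod_cast (by omega : 4 ≤ a t)
        rw [le_max_iff] at ih
        rcases ih with ih | ih
        · linarith
        · apply le_max_of_le_right
          rw [pow_succ]
          linarith
  refine ⟨bound, fun t ht => ?_⟩
  have hlt : (a t : ℝ) < 4 := (bound t).trans_lt (max_lt (by norm_num) ht)
  exact Nat.lt_succ_iff.mp (by exact_mod_cast hlt)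
end
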